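/- (Proposition 2, attitude error in Modified Rodrigues Parameters.) Let K_σ be a 3×3 real symmetric positive definite matrix with smallest eigenvalue k > 0, let w : [0,∞) → ℝ³ be continuous, and let σ : [0,∞) → ℝ³ be differentiable with sup_{t≥0} ‖σ(t)‖ ≤ c for some constant c < 1, satisfying the MRP error kinematics σ′(t) = (1/2)·G(σ(t))·( w(t) − K_σ σ(t) ) for all t ≥ 0, where G(σ) = ((1 − σᵀσ)/2)·Id₃ + [σ]ₓ + [σ]ₓ². Then the asymptotic bound ‖σ‖ₐ ≤ (1/k)·‖w‖ₐ holds, i.e. limsup_{t→∞} ‖σ(t)‖ ≤ (1/λ_min(K_σ))·limsup_{t→∞} ‖w(t)‖. -/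

import Mathlib

open Matrix Filter

open scoped ENNReal

/-- The 3×3 skew-symmetric cross-product matrix `[σ]ₓ`, with `[σ]ₓ x = σ × x`. -/
def crossMat (s : EuclideanSpace ℝ (Fin 3)) : Matrix (Fin 3) (Fin 3) ℝ :=
  !![0, -s 2, s 1;
     s 2, 0, -s 0;
     -s 1, s 0, 0]

/-- The MRP kinematics matrix `G(σ) = ((1 − σᵀσ)/2)·Id₃ + [σ]ₓ + [σ]ₓ²`. -/
noncomputable def mrpG (s : EuclideanSpace ℝ (Fin 3)) : Matrix (Fin 3) (Fin 3) ℝ :=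
  ((1 - ‖s‖ ^ 2) / 2) • (1 : Matrix (Fin 3) (Fin 3) ℝ) + crossMat s + crossMat s * crossMat s

/-- Rayleigh bound: a lower bound on the eigenvalues of a real symmetric matrix is a lower bound
on its quadratic form. -/
theorem Matrix.IsHermitian.mul_norm_sq_le_inner_toEuclideanLin {n : Type*} [Fintype n]
    [DecidableEq n] {A : Matrix n n ℝ} (hA : A.IsHermitian) {k : ℝ}
    (hk : ∀ i, k ≤ hA.eigenvalues i) (x : EuclideanSpace ℝ n) :
    k * ‖x‖ ^ 2 ≤ inner ℝ x (Matrix.toEuclideanLin A x) := by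
  have heig (i : n) : Matrix.toEuclideanLin A (hA.eigenvectorBasis i) =
      hA.eigenvalues i • hA.eigenvectorBasis i := by
    ext j
    simpa using congrFun (hA.mulVec_eigenvectorBasis i) j
  have hinner (i : n) : inner ℝ (hA.eigenvectorBasis i) (Matrix.toEuclideanLin A x) =
      hA.eigenvalues i * inner ℝ (hA.eigenvectorBasis i) x := by
    rw [← (Matrix.isSymmetric_toEuclideanLin_iff.mpr hA) _ x, heig, real_inner_smul_left]
  rw [← hA.eigenvectorBasis.sum_inner_mul_inner, ← hA.eigenvectorBasis.sum_sq_inner_right,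
    Finset.mul_sum]
  refine Finset.sum_le_sum fun i _ => ?_
  rw [hinner, real_inner_comm (hA.eigenvectorBasis i) x]
  nlinarith [mul_le_mul_of_nonneg_right (hk i)
    (sq_nonneg (inner ℝ (hA.eigenvectorBasis i) x))]

/-- The cross-product part of the MRP kinematics does not contribute along `s`. -/
theorem inner_toEuclideanLin_mrpG (s v : EuclideanSpace ℝ (Fin 3)) :
    inner ℝ s (Matrix.toEuclideanLin (mrpG s) v) = (1 - ‖s‖ ^ 2) / 2 * inner ℝ s v := by
  simp only [mrpG, crossMat, Matrix.toLpLin_apply, PiLp.inner_apply, Fin.sum_univ_three,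
    Matrix.mulVec, dotProduct, Matrix.add_apply, Matrix.smul_apply, Matrix.mul_apply]
  simp
  ring

/-- A nonnegative function whose derivative is bounded above by a negative constant whenever it is
at least `M` is eventually at most `M`. -/
theorem eventually_le_of_hasDerivAt_le_neg {f f' : ℝ → ℝ} {T M δ : ℝ} (hδ : 0 < δ)
    (hf0 : ∀ t, T ≤ t → 0 ≤ f t) (hf : ∀ t, T ≤ t → HasDerivAt f (f' t) t)
    (hf' : ∀ t, T ≤ t → M ≤ f t → f' t ≤ -δ) : ∀ᶠ t in atTop, f t ≤ M := by
  have hcont {a b : ℝ} (ha : T ≤ a) : ContinuousOn f (Set.Icc a b) := fun x hx =>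
    (hf x (ha.trans hx.1)).continuousAt.continuousWithinAt
  obtain ⟨t₁, ht₁, hM⟩ : ∃ t₁, T ≤ t₁ ∧ f t₁ ≤ M := by
    by_contra! h
    have hfT := hf0 T le_rfl
    have hlen : T ≤ T + (f T + 1) / δ := by
      have : 0 ≤ (f T + 1) / δ := by positivity
      linarith
    have hle := image_le_of_deriv_right_le_deriv_boundary (hcont le_rfl)
      (fun x hx => (hf x hx.1).hasDerivWithinAt) (B := fun t => f T - δ * (t - T))
      (B' := fun _ => -δ) (by simp) (by fun_prop)
      (fun x _ => by
        simpa using ((((hasDerivAt_id x).sub_const T).const_mul δ).const_sub (f T)).hasDerivWithinAt)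
      (fun x hx => hf' x hx.1 (h x hx.1).le) (Set.right_mem_Icc.mpr hlen)
    have hpos := hf0 _ hlen
    have hmul : δ * ((f T + 1) / δ) = f T + 1 := by field_simp
    simp only [add_sub_cancel_left] at hle
    linarith
  filter_upwards [eventually_ge_atTop t₁] with t ht
  exact image_le_of_deriv_right_lt_deriv_boundary (hcont ht₁)
    (fun x hx => (hf x (ht₁.trans hx.1)).hasDerivWithinAt) (B := fun _ => M) (B' := fun _ => 0)
    hM (fun x => hasDerivAt_const x M)
    (fun x hx hx' => (hf' x (ht₁.trans hx.1) hx'.ge).trans_lt (by linarith))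
    (Set.right_mem_Icc.mpr ht)

/-- Proposition 2, attitude error in Modified Rodrigues Parameters.
Let `K_σ` be a 3×3 real symmetric positive definite matrix with smallest eigenvalue
`k > 0`, let `w` be continuous, and let `σ` be differentiable with
`sup_{t≥0} ‖σ(t)‖ ≤ c` for some `c < 1` and satisfying the MRP error kinematics
`σ′(t) = (1/2)·G(σ(t))·(w(t) − K_σ σ(t))` for all `t ≥ 0`. Then
`limsup_{t→∞} ‖σ(t)‖ ≤ (1/λ_min(K_σ))·limsup_{t→∞} ‖w(t)‖`. -/
theorem iss_mrp_attitude_error (Kσ : Matrix (Fin 3) (Fin 3) ℝ) (hK : Kσ.PosDef)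
    (k : ℝ) (hk : 0 < k) (hkmin : IsLeast (Set.range hK.isHermitian.eigenvalues) k)
    (w σ : ℝ → EuclideanSpace ℝ (Fin 3)) (hw : Continuous w)
    (c : ℝ) (hc : c < 1) (hσbd : ∀ t, 0 ≤ t → ‖σ t‖ ≤ c)
    (hσ : ∀ t, 0 ≤ t →
      HasDerivAt σ
        ((1 / 2 : ℝ) •
          Matrix.toEuclideanLin (mrpG (σ t)) (w t - Matrix.toEuclideanLin Kσ (σ t))) t) :
    limsup (fun t => (‖σ t‖₊ : ℝ≥0∞)) atTop ≤
      ENNReal.ofReal (1 / k) * limsup (fun t => (‖w t‖₊ : ℝ≥0∞)) atTop := by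
  by_cases htop : limsup (fun t => (‖w t‖₊ : ℝ≥0∞)) atTop = ⊤
  · rw [htop, ENNReal.mul_top (by simpa using hk)]
    exact le_top
  refine le_of_forall_gt_imp_ge_of_dense fun r hr => ?_
  induction r with
  | top => exact le_top
  | coe a =>
  have hlim : limsup (fun t => (‖w t‖₊ : ℝ≥0∞)) atTop < ENNReal.ofReal (k * a) := by
    lift limsup (fun t => (‖w t‖₊ : ℝ≥0∞)) atTop to NNReal using htop with L
    rw [← ENNReal.ofReal_coe_nnreal, ← ENNReal.ofReal_mul (by positivity),
      ← ENNReal.ofReal_coe_nnreal] at hr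
    have hL := (ENNReal.ofReal_lt_ofReal_iff_of_nonneg (by positivity)).mp hr
    rw [← ENNReal.ofReal_coe_nnreal, ENNReal.ofReal_lt_ofReal_iff_of_nonneg (by positivity)]
    rw [one_div_mul_eq_div, div_lt_iff₀ hk] at hL
    linarith
  obtain ⟨b, hLb, hb⟩ := ENNReal.lt_iff_exists_nnreal_btwn.mp hlim
  rw [← ENNReal.ofReal_coe_nnreal,
    ENNReal.ofReal_lt_ofReal_iff_of_nonneg (by positivity)] at hb
  have ha : 0 < (a : ℝ) := pos_of_mul_pos_right (b.2.trans_lt hb) hk.le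
  obtain ⟨T, hT⟩ := eventually_atTop.mp (eventually_lt_of_limsup_lt hLb)
  have hc0 : 0 ≤ c := (norm_nonneg _).trans (hσbd 0 le_rfl)
  have hc2 : 0 < (1 - c ^ 2) / 2 := by nlinarith
  have hgap : 0 < (a : ℝ) * (k * a - b) := mul_pos ha (sub_pos.mpr hb)
  have hev := eventually_le_of_hasDerivAt_le_neg (f := fun t => ‖σ t‖ ^ 2) (T := max T 0)
    (M := (a : ℝ) ^ 2) (mul_pos hc2 hgap) (fun t _ => by positivity)
    (fun t ht => (hσ t ((le_max_right _ _).trans ht)).norm_sq) (fun t ht haσ => by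
      have hwb : ‖w t‖ ≤ b := by exact_mod_cast (hT t ((le_max_left _ _).trans ht)).le
      have hsc := hσbd t ((le_max_right _ _).trans ht)
      have has : (a : ℝ) ≤ ‖σ t‖ := (sq_le_sq₀ ha.le (norm_nonneg _)).mp haσ
      have hray := hK.isHermitian.mul_norm_sq_le_inner_toEuclideanLin
        (fun i => hkmin.2 ⟨i, rfl⟩) (σ t)
      have hcs : inner ℝ (σ t) (w t) ≤ ‖σ t‖ * b :=
        (real_inner_le_norm _ _).trans (by gcongr)
      have hdecay : inner ℝ (σ t) (w t - Matrix.toEuclideanLin Kσ (σ t)) ≤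
          -(a * (k * a - b)) := by
        rw [inner_sub_right]
        have hmul : (a : ℝ) * (k * a - b) ≤ ‖σ t‖ * (k * ‖σ t‖ - b) := by gcongr
        nlinarith
      have hfac : (1 - c ^ 2) / 2 ≤ (1 - ‖σ t‖ ^ 2) / 2 := by gcongr
      rw [real_inner_smul_right, inner_toEuclideanLin_mrpG]
      nlinarith [mul_le_mul_of_nonneg_right hfac hgap.le,
        mul_le_mul_of_nonneg_left hdecay (hc2.le.trans hfac)])
  refine limsup_le_of_le (by isBoundedDefault) (hev.mono fun t ht => ?_)
  exact_mod_cast (sq_le_sq₀ (norm_nonneg _) ha.le).mp ht
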